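/- For every integer n with |n| ≥ 2, the solvable Baumslag–Solitar group BS(1,n) = ⟨a, t | t a t⁻¹ = aⁿ⟩ admits no properly discontinuous action by semi-simple isometries on any CAT(0) metric space. -/

import Mathlib

/-! Common definitions: geodesic spaces, CAT(0) spaces, covering dimension,
translation length, semi-simple isometries, properly discontinuous actions,
ℝ-trees, axes, flat strips, and Artin group presentations. -/

/-- The alternating product `x y x y ⋯` of length `k`. -/
def altProd {G : Type*} [Monoid G] (x y : G) : ℕ → G
  | 0 => 1
  | Nat.succ k => x * altProd y x k

/-- `γ` is a geodesic from `x` to `y`, i.e. an isometric map of `[0, dist x y]`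
into the space with endpoints `x` and `y`. -/
def IsGeodesic {X : Type*} [MetricSpace X] (x y : X) (γ : ℝ → X) : Prop :=
  γ 0 = x ∧ γ (dist x y) = y ∧
    ∀ s ∈ Set.Icc (0:ℝ) (dist x y), ∀ t ∈ Set.Icc (0:ℝ) (dist x y),
      dist (γ s) (γ t) = |s - t|

/-- A metric space is geodesic if any two points are joined by a geodesic. -/
def IsGeodesicSpace (X : Type*) [MetricSpace X] : Prop :=
  ∀ x y : X, ∃ γ : ℝ → X, IsGeodesic x y γ

/-- The comparison point at arclength parameter `s` on the Euclidean segment from `x'`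
to `y'`, where `d` is the length of the corresponding side of the original triangle. -/
noncomputable def cmpPoint (d : ℝ) (x' y' : EuclideanSpace ℝ (Fin 2)) (s : ℝ) :
    EuclideanSpace ℝ (Fin 2) :=
  x' + (s / d) • (y' - x')

/-- A CAT(0) space: a geodesic metric space in which every geodesic triangle satisfies
the comparison inequality with respect to a comparison triangle in the Euclidean plane. -/
def IsCAT0 (X : Type*) [MetricSpace X] : Prop :=
  IsGeodesicSpace X ∧
  ∀ (x y z : X) (γ₁ γ₂ : ℝ → X), IsGeodesic x y γ₁ → IsGeodesic x z γ₂ →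
    ∀ x' y' z' : EuclideanSpace ℝ (Fin 2),
      dist x' y' = dist x y → dist x' z' = dist x z → dist y' z' = dist y z →
      ∀ s ∈ Set.Icc (0:ℝ) (dist x y), ∀ t ∈ Set.Icc (0:ℝ) (dist x z),
        dist (γ₁ s) (γ₂ t) ≤
          dist (cmpPoint (dist x y) x' y' s) (cmpPoint (dist x z) x' z' t)

/-- Covering dimension at most `n`: every open cover admits an open refinement in which
every point lies in at most `n + 1` members. -/
def CovDimLE (X : Type*) [TopologicalSpace X] (n : ℕ) : Prop :=
  ∀ U : Set (Set X), (∀ u ∈ U, IsOpen u) → ⋃₀ U = Set.univ →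
    ∃ V : Set (Set X), (∀ v ∈ V, IsOpen v) ∧ ⋃₀ V = Set.univ ∧
      (∀ v ∈ V, ∃ u ∈ U, v ⊆ u) ∧
      ∀ x : X, ∃ F : Finset (Set X), F.card ≤ n + 1 ∧ {v | v ∈ V ∧ x ∈ v} ⊆ ↑F

/-- The translation length of a self-map of a metric space. -/
noncomputable def transLen {X : Type*} [MetricSpace X] (f : X → X) : ℝ :=
  sInf (Set.range fun x => dist x (f x))

/-- A self-map is semi-simple if its translation length is attained. -/
def SemiSimple {X : Type*} [MetricSpace X] (f : X → X) : Prop :=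
  ∃ x, dist x (f x) = transLen f

/-- The minset of a self-map of a metric space. -/
def MinSet {X : Type*} [MetricSpace X] (f : X → X) : Set X :=
  {x | dist x (f x) = transLen f}

/-- An action by isometries (given by a homomorphism to the isometry group) is properly
discontinuous if each compact set meets only finitely many of its translates. -/
def ProperlyDisc {G X : Type*} [Group G] [MetricSpace X] (φ : G →* (X ≃ᵢ X)) : Prop :=
  ∀ K : Set X, IsCompact K → Set.Finite {g : G | ((φ g) '' K ∩ K).Nonempty}

/-- An ℝ-tree: a geodesic metric space satisfying the four-point condition. -/
def IsRTree (T : Type*) [MetricSpace T] : Prop :=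
  IsGeodesicSpace T ∧
  ∀ x y z w : T,
    dist x y + dist z w ≤ max (dist x z + dist y w) (dist x w + dist y z)

/-- `L` is an axis of `f`: an `f`-invariant geodesic line along which `f` translates
by its translation length. -/
def IsAxisOf {X : Type*} [MetricSpace X] (f : X → X) (L : Set X) : Prop :=
  ∃ c : ℝ → X, (∀ s t : ℝ, dist (c s) (c t) = |s - t|) ∧ Set.range c = L ∧
    ∀ t : ℝ, f (c t) = c (t + transLen f)

/-- `j` is an isometric embedding of the Euclidean strip `[0,w] × ℝ` into `X`. -/
def FlatStrip {X : Type*} [MetricSpace X] (w : ℝ) (j : Set.Icc (0:ℝ) w × ℝ → X) : Prop :=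
  ∀ p q : Set.Icc (0:ℝ) w × ℝ,
    dist (j p) (j q) = Real.sqrt (((p.1 : ℝ) - (q.1 : ℝ))^2 + (p.2 - q.2)^2)

/-- The set `S` is a flat strip of some positive width `w`, each of whose vertical lines
is an axis of `f`. -/
def StripWithAxes {X : Type*} [MetricSpace X] (f : X → X) (S : Set X) : Prop :=
  ∃ w : ℝ, 0 < w ∧ ∃ j : Set.Icc (0:ℝ) w × ℝ → X,
    FlatStrip w j ∧ Set.range j = S ∧
    ∀ s : Set.Icc (0:ℝ) w, IsAxisOf f (Set.range fun t : ℝ => j (s, t))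

/-- The relations of the Artin group `A(m,n,2)` on generators `a = 0`, `b = 1`, `c = 2`:
`(a,b)_m = (b,a)_m`, `(b,c)_n = (c,b)_n` and `ac = ca`. -/
def artinRel3 (m n : ℕ) : Set (FreeGroup (Fin 3)) :=
  { altProd (FreeGroup.of 0) (FreeGroup.of 1) m *
      (altProd (FreeGroup.of 1) (FreeGroup.of 0) m)⁻¹,
    altProd (FreeGroup.of 1) (FreeGroup.of 2) n *
      (altProd (FreeGroup.of 2) (FreeGroup.of 1) n)⁻¹,
    FreeGroup.of 0 * FreeGroup.of 2 * (FreeGroup.of 0)⁻¹ * (FreeGroup.of 2)⁻¹ }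

/-- The relation of the dihedral-type Artin group `A(m)` on generators `a = 0`, `b = 1`:
`(a,b)_m = (b,a)_m`. -/
def dihedralRel (m : ℕ) : Set (FreeGroup (Fin 2)) :=
  { altProd (FreeGroup.of 0) (FreeGroup.of 1) m *
      (altProd (FreeGroup.of 1) (FreeGroup.of 0) m)⁻¹ }

/-- The relation `t a t⁻¹ = aⁿ` of the Baumslag–Solitar group `BS(1,n)` on generators
`a = 0`, `t = 1`. -/
def bsRel (n : ℤ) : Set (FreeGroup (Fin 2)) :=
  { FreeGroup.of 1 * FreeGroup.of 0 * (FreeGroup.of 1)⁻¹ * ((FreeGroup.of 0) ^ n)⁻¹ }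

theorem transLen_le_dist {X : Type*} [MetricSpace X] (f : X → X) (x : X) :
    transLen f ≤ dist x (f x) :=
  csInf_le ⟨0, by rintro _ ⟨y, rfl⟩; exact dist_nonneg⟩ ⟨x, rfl⟩

theorem exists_isosceles_triangle {d e : ℝ} (he : 0 ≤ e) (hed : e ≤ 2 * d) :
    ∃ x y z : EuclideanSpace ℝ (Fin 2), dist x y = d ∧ dist x z = d ∧ dist y z = e := by
  have hd : 0 ≤ d := by linarith
  have hh : 0 ≤ d ^ 2 - (e / 2) ^ 2 := by nlinarith
  refine ⟨!₂[0, √(d ^ 2 - (e / 2) ^ 2)], !₂[-(e / 2), 0], !₂[e / 2, 0], ?_, ?_, ?_⟩ <;>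
    rw [EuclideanSpace.dist_eq, Real.sqrt_eq_iff_mul_self_eq (by positivity) (by assumption)] <;>
    simp [Real.dist_eq, Real.sq_sqrt hh] <;> ring

theorem IsGeodesic.reverse {X : Type*} [MetricSpace X] {x y : X} {γ : ℝ → X}
    (h : IsGeodesic x y γ) : IsGeodesic y x fun s => γ (dist x y - s) := by
  obtain ⟨h0, h1, h2⟩ := h
  refine ⟨by simpa using h1, by simpa [dist_comm y x] using h0, fun s hs t ht => ?_⟩
  rw [dist_comm y x] at hs ht
  rw [h2 _ ⟨by linarith [hs.2], by linarith [hs.1]⟩ _ ⟨by linarith [ht.2], by linarith [ht.1]⟩,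
    abs_sub_comm]
  congr 1
  ring

theorem IsGeodesic.map_isometry {X : Type*} [MetricSpace X] {x y : X} {γ : ℝ → X}
    (h : IsGeodesic x y γ) {f : X → X} (hf : Isometry f) :
    IsGeodesic (f x) (f y) (f ∘ γ) := by
  obtain ⟨h0, h1, h2⟩ := h
  refine ⟨by simp [h0], by simp [hf.dist_eq, h1], ?_⟩
  simpa only [hf.dist_eq, Function.comp_apply] using h2

theorem IsCAT0.transLen_le_half_dist {X : Type*} [MetricSpace X] (hX : IsCAT0 X)
    {f : X → X} (hf : Isometry f) (x : X) : transLen f ≤ dist x (f (f x)) / 2 := by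
  obtain ⟨γ, hγ⟩ := hX.1 x (f x)
  set d := dist x (f x) with hd
  have hd0 : 0 ≤ d := dist_nonneg
  have hfd : dist (f x) (f (f x)) = d := hf.dist_eq x (f x)
  have hdx : dist (f x) x = d := dist_comm _ _
  have htri : dist x (f (f x)) ≤ 2 * d := by
    linarith [dist_triangle x (f x) (f (f x))]
  obtain ⟨p, q, r, hpq, hpr, hqr⟩ := exists_isosceles_triangle dist_nonneg htri
  have hcmp := hX.2 (f x) x (f (f x)) _ _ hγ.reverse (hγ.map_isometry hf) p q r
    (by rw [hpq, hdx]) (by rw [hpr, hfd]) hqr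
    (d / 2) (by rw [hdx]; constructor <;> linarith) (d / 2) (by rw [hfd]; constructor <;> linarith)
  have hmid : d - d / 2 = d / 2 := by ring
  simp only [← hd, hmid, Function.comp_apply, hdx, hfd, cmpPoint] at hcmp
  rw [dist_add_left, dist_smul₀, dist_sub_right, hqr] at hcmp
  have hle : ‖d / 2 / d‖ ≤ 1 / 2 := by
    rw [Real.norm_of_nonneg (by positivity)]
    exact div_le_of_le_mul₀ hd0 (by norm_num) (by linarith)
  calc transLen f ≤ dist (γ (d / 2)) (f (γ (d / 2))) := transLen_le_dist f _
    _ ≤ ‖d / 2 / d‖ * dist x (f (f x)) := hcmp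
    _ ≤ 1 / 2 * dist x (f (f x)) := by gcongr
    _ = dist x (f (f x)) / 2 := by ring

theorem IsCAT0.two_pow_mul_transLen_le_dist {X : Type*} [MetricSpace X] (hX : IsCAT0 X)
    (f : X ≃ᵢ X) (k : ℕ) (x : X) : 2 ^ k * transLen f ≤ dist x ((f ^ 2 ^ k) x) := by
  induction k generalizing x with
  | zero => simpa using transLen_le_dist f x
  | succ k ih =>
    have hk : 2 ^ k * transLen f ≤ transLen ⇑(f ^ 2 ^ k) :=
      le_csInf ⟨_, x, rfl⟩ (by rintro _ ⟨y, rfl⟩; exact ih y)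
    have hhalf := hX.transLen_le_half_dist (f ^ 2 ^ k).isometry x
    rw [← IsometryEquiv.mul_apply, ← pow_add, ← mul_two, ← pow_succ] at hhalf
    rw [pow_succ (2 : ℝ)]
    linarith

theorem dist_pow_le {X : Type*} [MetricSpace X] (f : X ≃ᵢ X) (k : ℕ) (x : X) :
    dist x ((f ^ k) x) ≤ k * dist x (f x) := by
  induction k with
  | zero => simp
  | succ k ih =>
    have h := dist_triangle x ((f ^ k) x) ((f ^ (k + 1)) x)
    rw [pow_succ f k, IsometryEquiv.mul_apply, (f ^ k).dist_eq] at h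
    rw [pow_succ f k, IsometryEquiv.mul_apply]
    push_cast
    linarith

theorem IsCAT0.mul_transLen_le_dist_pow {X : Type*} [MetricSpace X] (hX : IsCAT0 X)
    (f : X ≃ᵢ X) {x : X} (hx : dist x (f x) = transLen f) (m : ℕ) :
    m * transLen f ≤ dist x ((f ^ m) x) := by
  have hm : m ≤ 2 ^ m := Nat.lt_two_pow_self.le
  have hlow := hX.two_pow_mul_transLen_le_dist f m x
  have htri := dist_triangle x ((f ^ m) x) ((f ^ 2 ^ m) x)
  have hup := dist_pow_le f (2 ^ m - m) x
  have hsplit : dist ((f ^ m) x) ((f ^ 2 ^ m) x) = dist x ((f ^ (2 ^ m - m)) x) := by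
    conv_lhs => rw [← Nat.add_sub_of_le hm, pow_add, IsometryEquiv.mul_apply]
    exact (f ^ m).dist_eq _ _
  rw [Nat.cast_sub hm, hx] at hup
  push_cast at hup
  linarith

theorem dist_zpow_eq_dist_pow_natAbs {X : Type*} [MetricSpace X] (f : X ≃ᵢ X) (m : ℤ) (x : X) :
    dist x ((f ^ m) x) = dist x ((f ^ m.natAbs) x) := by
  obtain h | h := Int.natAbs_eq m
  · conv_lhs => rw [h, zpow_natCast]
  · conv_lhs => rw [h, zpow_neg, zpow_natCast]
    rw [← (f ^ m.natAbs).dist_eq, ← IsometryEquiv.mul_apply, mul_inv_cancel, dist_comm]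
    rfl

theorem IsCAT0.transLen_eq_zero_of_conj_eq_zpow {X : Type*} [MetricSpace X] (hX : IsCAT0 X)
    {f t : X ≃ᵢ X} {n : ℤ} (hn : 2 ≤ |n|) (hft : t * f * t⁻¹ = f ^ n) (hf : SemiSimple f) :
    transLen f = 0 := by
  obtain ⟨x, hx⟩ := hf
  have hℓ : 0 ≤ transLen f := hx ▸ dist_nonneg
  have hconj : dist (t x) ((f ^ n) (t x)) = transLen f := by
    rw [← hft, ← hx]
    simp [IsometryEquiv.mul_apply, ← IsometryEquiv.mul_apply t⁻¹ t, t.dist_eq]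
  have hbound (k : ℕ) : k * transLen f ≤ 2 * dist x (t x) := by
    have hup := dist_pow_le (f ^ n) k (t x)
    have hlow := hX.mul_transLen_le_dist_pow f hx (n * k).natAbs
    rw [← dist_zpow_eq_dist_pow_natAbs, zpow_mul, zpow_natCast, Nat.cast_natAbs, abs_mul,
      Nat.abs_cast] at hlow
    have htri := dist_triangle4 x (t x) (((f ^ n) ^ k) (t x)) (((f ^ n) ^ k) x)
    rw [((f ^ n) ^ k).dist_eq, dist_comm (t x) x] at htri
    rw [hconj] at hup
    have hn' : (2 : ℝ) ≤ (|n| : ℤ) := by exact_mod_cast hn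
    have hk : 0 ≤ k * transLen f := by positivity
    push_cast at hlow hn'
    nlinarith
  by_contra hne
  obtain ⟨k, hk⟩ := Archimedean.arch (2 * dist x (t x) + 1) (lt_of_le_of_ne hℓ (Ne.symm hne))
  rw [nsmul_eq_mul] at hk
  linarith [hbound k]

theorem bs_conj_eq_zpow (n : ℤ) :
    (PresentedGroup.of 1 * PresentedGroup.of 0 * (PresentedGroup.of 1)⁻¹ :
      PresentedGroup (bsRel n)) = PresentedGroup.of 0 ^ n := by
  have h : PresentedGroup.mk (bsRel n) (FreeGroup.of 1 * FreeGroup.of 0 * (FreeGroup.of 1)⁻¹ *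
      (FreeGroup.of 0 ^ n)⁻¹) = 1 := PresentedGroup.one_of_mem rfl
  rwa [map_mul, map_inv, mul_inv_eq_one, map_mul, map_mul, map_inv, map_zpow] at h

theorem bs_zpow_injective {n : ℤ} (hn : n ≠ 0) :
    Function.Injective fun k : ℤ => (PresentedGroup.of 0 : PresentedGroup (bsRel n)) ^ k := by
  have hn' : (n : ℚ) ≠ 0 := by exact_mod_cast hn
  have hpow (k : ℤ) (q : ℚ) : ((Equiv.addRight (1 : ℚ)) ^ k) q = q + k := by simp
  let v : Fin 2 → Equiv.Perm ℚ := ![Equiv.addRight 1, Equiv.mulLeft₀ (n : ℚ) hn']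
  have hv : ∀ r ∈ bsRel n, FreeGroup.lift v r = 1 := by
    rintro _ rfl
    simp only [map_mul, map_inv, map_zpow, FreeGroup.lift_apply_of, mul_inv_eq_one]
    ext q
    simp only [v, Matrix.cons_val_zero, Matrix.cons_val_one, hpow]
    simpa [Equiv.Perm.mul_apply, mul_add] using
      (Equiv.mulLeft₀ (n : ℚ) hn').apply_symm_apply q
  intro j k hjk
  have h := congrArg (fun g => PresentedGroup.toGroup hv g 0) hjk
  simp only [map_zpow, PresentedGroup.toGroup.of] at h
  simp only [v, Matrix.cons_val_zero, hpow, zero_add] at h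
  exact_mod_cast h

/-- For `|n| ≥ 2`, the solvable Baumslag–Solitar group `BS(1,n)`
admits no properly discontinuous action by semi-simple isometries on any CAT(0) space. -/
theorem bs_no_semisimple_action
    (n : ℤ) (hn : 2 ≤ |n|)
    (X : Type*) [MetricSpace X] (hX : IsCAT0 X)
    (φ : PresentedGroup (bsRel n) →* (X ≃ᵢ X))
    (hpd : ProperlyDisc φ) (hss : ∀ g, SemiSimple ⇑(φ g)) : False := by
  have hn0 : n ≠ 0 := by rintro rfl; simp at hn
  set a : PresentedGroup (bsRel n) := PresentedGroup.of 0
  have hconj := congrArg φ (bs_conj_eq_zpow n)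
  simp only [map_mul, map_inv, map_zpow] at hconj
  have hℓ := hX.transLen_eq_zero_of_conj_eq_zpow hn hconj (hss a)
  obtain ⟨x, hx⟩ := hss a
  rw [hℓ, dist_eq_zero] at hx
  refine Set.infinite_range_of_injective (bs_zpow_injective hn0)
    ((hpd {x} isCompact_singleton).subset ?_)
  rintro _ ⟨k, rfl⟩
  have hfix : dist x ((φ a ^ k) x) = 0 := by
    rw [dist_zpow_eq_dist_pow_natAbs]
    refine le_antisymm ((dist_pow_le _ _ x).trans ?_) dist_nonneg
    rw [← hx, dist_self, mul_zero]
  exact ⟨x, ⟨x, rfl, by rw [map_zpow]; exact (dist_eq_zero.1 hfix).symm⟩, rfl⟩
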